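/- arXiv:1302.6924 — 2 statements merged into one kernel-verified Lean document; each statement's English description precedes it below -/
import Mathlib

section
/- Let C and D be pretriangulated categories, let F : C ⥤ D be a triangulated functor, and let B be an object of C. Suppose A₁ ⟶ A₂ ⟶ A₃ ⟶ A₁⟦1⟧ is a distinguished triangle in C such that for i = 1, 2 and every n ∈ ℤ the map Hom_C(A_i⟦n⟧, B) → Hom_D(F(A_i⟦n⟧), F(B)) induced by F is bijective. Then for every n ∈ ℤ the map Hom_C(A₃⟦n⟧, B) → Hom_D(F(A₃⟦n⟧), F(B)) induced by F is bijective. -/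
open CategoryTheory Category Limits Pretriangulated

namespace CategoryTheory.Functor

lemma map_bijective_of_iso {C D : Type*} [Category C] [Category D] (F : C ⥤ D)
    {X Y B : C} (e : X ≅ Y) (h : Function.Bijective (fun f : X ⟶ B => F.map f)) :
    Function.Bijective (fun f : Y ⟶ B => F.map f) := by
  refine ⟨fun f g hfg => ?_, fun y => ?_⟩
  · rw [← cancel_epi e.hom]
    apply h.1
    simp only [map_comp] at hfg ⊢
    rw [hfg]
  · obtain ⟨x, hx⟩ := h.2 (F.map e.hom ≫ y)
    refine ⟨e.inv ≫ x, ?_⟩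
    dsimp only at hx ⊢
    rw [map_comp, hx, ← map_comp_assoc, e.inv_hom_id, F.map_id, id_comp]

variable {C D : Type*} [Category C] [Category D]
  [HasZeroObject C] [HasZeroObject D] [Preadditive C] [Preadditive D]
  [HasShift C ℤ] [HasShift D ℤ]
  [∀ n : ℤ, (shiftFunctor C n).Additive] [∀ n : ℤ, (shiftFunctor D n).Additive]
  [Pretriangulated C] [Pretriangulated D]
  (F : C ⥤ D) [F.CommShift ℤ] [F.IsTriangulated]

lemma yoneda_exact_map {T : Triangle C} (hT : T ∈ distTriang C) {Y : D}
    (f : F.obj T.obj₂ ⟶ Y) (hf : F.map T.mor₁ ≫ f = 0) :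
    ∃ g : F.obj T.obj₃ ⟶ Y, f = F.map T.mor₂ ≫ g :=
  Triangle.yoneda_exact₂ _ (F.map_distinguished T hT) f hf

/-- The five lemma for the maps induced by a triangulated functor on the long exact sequence
of morphisms from a distinguished triangle to a fixed object. -/
lemma map_bijective_obj₃ {B : C} {T : Triangle C} (hT : T ∈ distTriang C)
    (h₁ : Function.Injective (fun f : T.obj₁ ⟶ B => F.map f))
    (h₂ : Function.Bijective (fun f : T.obj₂ ⟶ B => F.map f))
    (h₁' : Function.Bijective (fun f : T.obj₁⟦(1 : ℤ)⟧ ⟶ B => F.map f))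
    (h₂' : Function.Surjective (fun f : T.obj₂⟦(1 : ℤ)⟧ ⟶ B => F.map f)) :
    Function.Bijective (fun f : T.obj₃ ⟶ B => F.map f) := by
  have hT' := rot_of_distTriang _ hT
  constructor
  · change Function.Injective (F.mapAddHom (X := T.obj₃) (Y := B))
    rw [injective_iff_map_eq_zero]
    intro f hf
    change F.map f = 0 at hf
    obtain ⟨g, rfl⟩ := T.yoneda_exact₃ hT f (h₂.1 (by simp [hf]))
    obtain ⟨y, hy⟩ := F.yoneda_exact_map (rot_of_distTriang _ hT') (F.map g)
      ((F.map_comp _ _).symm.trans hf)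
    obtain ⟨k, rfl⟩ := h₂' y
    obtain rfl : g = T.rotate.rotate.mor₂ ≫ k :=
      h₁'.1 (hy.trans (F.map_comp _ _).symm)
    exact comp_distTriang_mor_zero₁₂_assoc _ (rot_of_distTriang _ hT') k |>.trans zero_comp
  · intro y
    obtain ⟨u, hu⟩ := h₂.2 (F.map T.mor₂ ≫ y)
    dsimp only at hu
    obtain ⟨v, rfl⟩ := T.yoneda_exact₂ hT u (h₁ (by
      dsimp only
      rw [F.map_comp, hu, ← F.map_comp_assoc, comp_distTriang_mor_zero₁₂ _ hT]
      simp))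
    obtain ⟨w, hw⟩ := F.yoneda_exact_map hT' (y - F.map v) (by
      change F.map T.mor₂ ≫ (y - F.map v) = 0
      rw [Preadditive.comp_sub, ← hu, F.map_comp, sub_self])
    obtain ⟨z, rfl⟩ := h₁'.2 w
    refine ⟨v + T.mor₃ ≫ z, ?_⟩
    dsimp only
    rw [F.map_add, F.map_comp]
    exact (sub_eq_iff_eq_add'.1 hw).symm

end CategoryTheory.Functor

theorem devissage_contravariant
    {C D : Type*} [Category C] [Category D]
    [HasZeroObject C] [HasZeroObject D] [Preadditive C] [Preadditive D]
    [HasShift C ℤ] [HasShift D ℤ]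
    [∀ n : ℤ, (shiftFunctor C n).Additive] [∀ n : ℤ, (shiftFunctor D n).Additive]
    [Pretriangulated C] [Pretriangulated D]
    (F : C ⥤ D) [F.CommShift ℤ] [F.IsTriangulated]
    (B : C) (T : Triangle C) (hT : T ∈ distTriang C)
    (h1 : ∀ n : ℤ, Function.Bijective (fun f : T.obj₁⟦n⟧ ⟶ B => F.map f))
    (h2 : ∀ n : ℤ, Function.Bijective (fun f : T.obj₂⟦n⟧ ⟶ B => F.map f)) :
    ∀ n : ℤ, Function.Bijective (fun f : T.obj₃⟦n⟧ ⟶ B => F.map f) := by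
  intro n
  exact F.map_bijective_obj₃ (Triangle.shift_distinguished T hT n) (h1 n).1 (h2 n)
    (F.map_bijective_of_iso ((shiftFunctorAdd C n 1).app T.obj₁) (h1 (n + 1)))
    (F.map_bijective_of_iso ((shiftFunctorAdd C n 1).app T.obj₂) (h2 (n + 1))).2
end

section
/- Let C and D be pretriangulated categories, let F : C ⥤ D be a triangulated functor, and let S be a set of objects of C such that for all A, B ∈ S and every n ∈ ℤ the map Hom_C(A⟦n⟧, B) → Hom_D(F(A⟦n⟧), F(B)) induced by F is bijective. Call a class P of objects of C admissible if it contains S, contains the zero objects, is closed under isomorphism, satisfies X ∈ P ↔ X⟦n⟧ ∈ P for all n ∈ ℤ, contains the third object of any distinguished triangle whose other two objects lie in P, and contains every retract of an object of P. Then for all objects A and B of C that belong to every admissible class P (i.e., A and B lie in the thick triangulated subcategory of C generated by S), the map Hom_C(A, B) → Hom_D(F(A), F(B)) induced by F is bijective; in other words, F is fully faithful on the thick triangulated subcategory generated by S. -/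
open CategoryTheory Category Limits Pretriangulated

/-- A class `P` of objects of a pretriangulated category `C` is *admissible*
(relative to a set of objects `S`) if it contains `S`, contains the zero objects,
is closed under isomorphism, is stable under the shift functors, contains the third
object of any distinguished triangle whose first two objects lie in `P`, and contains
every retract of an object of `P`. -/
def Admissible {C : Type*} [Category C]
    [HasZeroObject C] [Preadditive C] [HasShift C ℤ]
    [∀ n : ℤ, (shiftFunctor C n).Additive] [Pretriangulated C]
    (S : Set C) (P : Set C) : Prop :=
  S ⊆ P ∧
  (∀ X : C, IsZero X → X ∈ P) ∧
  (∀ X Y : C, (X ≅ Y) → X ∈ P → Y ∈ P) ∧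
  (∀ (X : C) (n : ℤ), X ∈ P ↔ X⟦n⟧ ∈ P) ∧
  (∀ T : Triangle C, (T ∈ distTriang C) → T.obj₁ ∈ P → T.obj₂ ∈ P → T.obj₃ ∈ P) ∧
  (∀ X Y : C, ∀ i : X ⟶ Y, ∀ r : Y ⟶ X, i ≫ r = 𝟙 X → Y ∈ P → X ∈ P)

namespace CategoryTheory.Functor

section Retract

variable {C D : Type*} [Category C] [Category D] (F : C ⥤ D)

lemma map_bijective_of_retract {X Y X' Y' : C} (hX : Retract X X') (hY : Retract Y Y')
    (h : Function.Bijective (F.map : (X' ⟶ Y') → _)) :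
    Function.Bijective (F.map : (X ⟶ Y) → _) := by
  constructor
  · intro f g hfg
    have := h.1 (a₁ := hX.r ≫ f ≫ hY.i) (a₂ := hX.r ≫ g ≫ hY.i) (by simp [hfg])
    simpa using hX.i ≫= this =≫ hY.r
  · intro g
    obtain ⟨k, hk⟩ := h.2 (F.map hX.r ≫ g ≫ F.map hY.i)
    exact ⟨hX.i ≫ k ≫ hY.r, by simp [hk, ← F.map_comp_assoc, ← F.map_comp]⟩

lemma map_bijective_iff_of_iso {X Y X' Y' : C} (eX : X ≅ X') (eY : Y ≅ Y') :
    Function.Bijective (F.map : (X ⟶ Y) → _) ↔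
      Function.Bijective (F.map : (X' ⟶ Y') → _) :=
  ⟨F.map_bijective_of_retract (.ofIso eX.symm) (.ofIso eY.symm),
    F.map_bijective_of_retract (.ofIso eX) (.ofIso eY)⟩

end Retract

section GradedHom

variable {C D : Type*} [Category C] [Category D] [HasShift C ℤ] (F : C ⥤ D)

/-- `F` is bijective on all graded pieces of the graded hom group from `X` to `Y`. -/
def BijectiveOnGradedHom (X Y : C) : Prop :=
  ∀ n : ℤ, Function.Bijective (F.map : (X ⟶ Y⟦n⟧) → _)

variable {F}

lemma BijectiveOnGradedHom.of_retract {X Y X' Y' : C} (h : F.BijectiveOnGradedHom X' Y')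
    (hX : Retract X X') (hY : Retract Y Y') : F.BijectiveOnGradedHom X Y :=
  fun n ↦ F.map_bijective_of_retract hX (hY.map (shiftFunctor C n)) (h n)

lemma BijectiveOnGradedHom.map_bijective {X Y : C} (h : F.BijectiveOnGradedHom X Y) :
    Function.Bijective (F.map : (X ⟶ Y) → _) :=
  (F.map_bijective_iff_of_iso (Iso.refl X) ((shiftFunctorZero C ℤ).app Y)).1 (h 0)

lemma bijectiveOnGradedHom_shift_right_iff {X Y : C} (m : ℤ) :
    F.BijectiveOnGradedHom X (Y⟦m⟧) ↔ F.BijectiveOnGradedHom X Y := by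
  have key (n : ℤ) : Function.Bijective (F.map : (X ⟶ Y⟦m⟧⟦n⟧) → _) ↔
      Function.Bijective (F.map : (X ⟶ Y⟦m + n⟧) → _) :=
    F.map_bijective_iff_of_iso (Iso.refl _) (shiftAdd Y m n).symm
  simp_rw [BijectiveOnGradedHom, key]
  exact ⟨fun h n ↦ add_sub_cancel m n ▸ h (n - m), fun h n ↦ h (m + n)⟩

end GradedHom

section Shift

variable {C D : Type*} [Category C] [Category D] [HasShift C ℤ] [HasShift D ℤ]
  (F : C ⥤ D) [F.CommShift ℤ]

lemma map_bijective_shift_iff (X Y : C) (n : ℤ) :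
    Function.Bijective (F.map : (X⟦n⟧ ⟶ Y⟦n⟧) → _) ↔
      Function.Bijective (F.map : (X ⟶ Y) → _) := by
  have hC : Function.Bijective ((shiftFunctor C n).map : (X ⟶ Y) → _) :=
    Functor.FullyFaithful.map_bijective (.ofFullyFaithful _) X Y
  have hD : Function.Bijective ((shiftFunctor D n).map : (F.obj X ⟶ F.obj Y) → _) :=
    Functor.FullyFaithful.map_bijective (.ofFullyFaithful _) _ _
  let e := ((F.commShiftIso n).app X).homCongr ((F.commShiftIso n).app Y)
  have comm : e ∘ (F.map : (X⟦n⟧ ⟶ Y⟦n⟧) → _) ∘ (shiftFunctor C n).map =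
      (shiftFunctor D n).map ∘ F.map := by
    ext f
    have := (F.commShiftIso n).hom.naturality f
    dsimp at this
    simp [e, this]
  rw [← Function.Bijective.of_comp_iff _ hC, ← Function.Bijective.of_comp_iff' e.bijective, comm,
    Function.Bijective.of_comp_iff' hD]

lemma map_bijective_shift_left_iff (X Y : C) (n : ℤ) :
    Function.Bijective (F.map : (X⟦n⟧ ⟶ Y) → _) ↔
      Function.Bijective (F.map : (X ⟶ Y⟦-n⟧) → _) := by
  rw [← F.map_bijective_shift_iff X _ n]
  exact F.map_bijective_iff_of_iso (Iso.refl _) (shiftNegShift Y n).symm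

variable {F}

lemma bijectiveOnGradedHom_iff_left {X Y : C} :
    F.BijectiveOnGradedHom X Y ↔ ∀ n : ℤ, Function.Bijective (F.map : (X⟦n⟧ ⟶ Y) → _) := by
  simp_rw [map_bijective_shift_left_iff]
  exact ⟨fun h n ↦ h (-n), fun h n ↦ neg_neg n ▸ h (-n)⟩

lemma bijectiveOnGradedHom_shift_left_iff {X Y : C} (m : ℤ) :
    F.BijectiveOnGradedHom (X⟦m⟧) Y ↔ F.BijectiveOnGradedHom X Y := by
  have key (n : ℤ) : Function.Bijective (F.map : (X⟦m⟧⟦n⟧ ⟶ Y) → _) ↔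
      Function.Bijective (F.map : (X⟦m + n⟧ ⟶ Y) → _) :=
    F.map_bijective_iff_of_iso (shiftAdd X m n).symm (Iso.refl _)
  simp_rw [bijectiveOnGradedHom_iff_left, key]
  exact ⟨fun h n ↦ add_sub_cancel m n ▸ h (n - m), fun h n ↦ h (m + n)⟩

end Shift

section Triangulated

variable {C D : Type*} [Category C] [Category D]
  [HasZeroObject C] [HasZeroObject D] [Preadditive C] [Preadditive D]
  [HasShift C ℤ] [HasShift D ℤ]
  [∀ n : ℤ, (shiftFunctor C n).Additive] [∀ n : ℤ, (shiftFunctor D n).Additive]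
  [Pretriangulated C] [Pretriangulated D]
  {F : C ⥤ D} [F.CommShift ℤ] [F.IsTriangulated]

/-- The five lemma for the covariant long exact sequences of a distinguished triangle. -/
lemma map_bijective_obj₃_right {X : C} {T : Triangle C} (hT : T ∈ distTriang C)
    (h₁ : Function.Surjective (F.map : (X ⟶ T.obj₁) → _))
    (h₂ : Function.Bijective (F.map : (X ⟶ T.obj₂) → _))
    (h₃ : Function.Bijective (F.map : (X ⟶ T.obj₁⟦(1 : ℤ)⟧) → _))
    (h₄ : Function.Injective (F.map : (X ⟶ T.obj₂⟦(1 : ℤ)⟧) → _)) :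
    Function.Bijective (F.map : (X ⟶ T.obj₃) → _) := by
  have hFT := F.map_distinguished T hT
  have exact₂ (f : F.obj X ⟶ F.obj T.obj₂) (hf : f ≫ F.map T.mor₂ = 0) :
      ∃ g, f = g ≫ F.map T.mor₁ := Triangle.coyoneda_exact₂ _ hFT f hf
  have exact₃ (f : F.obj X ⟶ F.obj T.obj₃) (hf : f ≫ F.map T.mor₃ = 0) :
      ∃ g, f = g ≫ F.map T.mor₂ := Triangle.coyoneda_exact₃ _ hFT f (by
    simpa using! hf =≫ (F.commShiftIso (1 : ℤ)).hom.app T.obj₁)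
  constructor
  · refine (injective_iff_map_eq_zero (F.mapAddHom (X := X) (Y := T.obj₃))).2 fun f hf ↦ ?_
    replace hf : F.map f = 0 := hf
    obtain ⟨g, rfl⟩ := T.coyoneda_exact₃ hT f (h₃.1 (by simp [hf]))
    obtain ⟨l, hl⟩ := exact₂ (F.map g) (by simpa using hf)
    obtain ⟨k, rfl⟩ := h₁ l
    obtain rfl : g = k ≫ T.mor₁ := h₂.1 (by simpa using hl)
    simp [comp_distTriang_mor_zero₁₂ _ hT]
  · intro h
    obtain ⟨k, hk⟩ := h₃.2 (h ≫ F.map T.mor₃)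
    obtain ⟨l, rfl⟩ := T.coyoneda_exact₁ hT k (h₄ (by
      simp [hk, ← F.map_comp, comp_distTriang_mor_zero₃₁ _ hT]))
    obtain ⟨m, hm⟩ := exact₃ (h - F.map l) (by
      simpa [sub_eq_zero] using hk.symm)
    obtain ⟨p, rfl⟩ := h₂.2 m
    exact ⟨l + p ≫ T.mor₂, by simp [← hm]⟩

/-- The five lemma for the contravariant long exact sequences of a distinguished triangle. -/
lemma map_bijective_obj₃_left {Y : C} {T : Triangle C} (hT : T ∈ distTriang C)
    (h₁ : Function.Injective (F.map : (T.obj₁ ⟶ Y) → _))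
    (h₂ : Function.Bijective (F.map : (T.obj₂ ⟶ Y) → _))
    (h₃ : Function.Bijective (F.map : (T.obj₁⟦(1 : ℤ)⟧ ⟶ Y) → _))
    (h₄ : Function.Surjective (F.map : (T.obj₂⟦(1 : ℤ)⟧ ⟶ Y) → _)) :
    Function.Bijective (F.map : (T.obj₃ ⟶ Y) → _) := by
  have exact₃ (f : F.obj T.obj₃ ⟶ F.obj Y) (hf : F.map T.mor₂ ≫ f = 0) :
      ∃ g : F.obj (T.obj₁⟦(1 : ℤ)⟧) ⟶ F.obj Y, f = F.map T.mor₃ ≫ g := by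
    obtain ⟨g, hg⟩ := Triangle.yoneda_exact₃ _ (F.map_distinguished T hT) f hf
    exact ⟨(F.commShiftIso (1 : ℤ)).hom.app T.obj₁ ≫ g, hg.trans (Category.assoc _ _ _)⟩
  have exact₁ (f : F.obj (T.obj₁⟦(1 : ℤ)⟧) ⟶ F.obj Y) (hf : F.map T.mor₃ ≫ f = 0) :
      ∃ g : F.obj (T.obj₂⟦(1 : ℤ)⟧) ⟶ F.obj Y, f = F.map (-T.mor₁⟦(1 : ℤ)⟧') ≫ g := by
    obtain ⟨g, hg⟩ := Triangle.yoneda_exact₃ _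
      (F.map_distinguished _ (rot_of_distTriang T hT)) f hf
    exact ⟨(F.commShiftIso (1 : ℤ)).hom.app T.obj₂ ≫ g, hg.trans (Category.assoc _ _ _)⟩
  constructor
  · refine (injective_iff_map_eq_zero (F.mapAddHom (X := T.obj₃) (Y := Y))).2 fun f hf ↦ ?_
    replace hf : F.map f = 0 := hf
    obtain ⟨g, rfl⟩ := T.yoneda_exact₃ hT f (h₂.1 (by simp [hf]))
    obtain ⟨l, hl⟩ := exact₁ (F.map g) (by simpa using hf)
    obtain ⟨k, rfl⟩ := h₄ l
    obtain rfl : g = (-T.mor₁⟦(1 : ℤ)⟧') ≫ k := h₃.1 (by simpa using hl)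
    simp [comp_distTriang_mor_zero₃₁_assoc _ hT]
  · intro h
    obtain ⟨k, hk⟩ := h₂.2 (F.map T.mor₂ ≫ h)
    obtain ⟨l, rfl⟩ := T.yoneda_exact₂ hT k (h₁ (by
      simp [hk, ← F.map_comp_assoc, comp_distTriang_mor_zero₁₂ _ hT]))
    obtain ⟨m, hm⟩ := exact₃ (h - F.map l) (by
      simpa [sub_eq_zero] using hk.symm)
    obtain ⟨p, rfl⟩ := h₃.2 m
    exact ⟨l + T.mor₃ ≫ p, by simp [← hm]⟩

lemma admissible_bijectiveOnGradedHom_right {S : Set C} {X : C}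
    (hS : ∀ Y ∈ S, F.BijectiveOnGradedHom X Y) :
    Admissible S {Y | F.BijectiveOnGradedHom X Y} := by
  refine ⟨hS, fun Y hY n ↦ ?_, fun Y Y' e hY ↦ hY.of_retract (.refl _) (.ofIso e.symm),
    fun Y n ↦ (bijectiveOnGradedHom_shift_right_iff n).symm, fun T hT h₁ h₂ ↦ ?_,
    fun Y Y' i r hir hY ↦ hY.of_retract (.refl _) ⟨i, r, hir⟩⟩
  · have hY' := (shiftFunctor C n).map_isZero hY
    exact ⟨fun _ _ _ ↦ hY'.eq_of_tgt _ _, fun _ ↦ ⟨0, (F.map_isZero hY').eq_of_tgt _ _⟩⟩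
  · refine bijectiveOnGradedHom_iff_left.2 fun n ↦ ?_
    replace h₁ := (bijectiveOnGradedHom_shift_left_iff n).2 h₁
    replace h₂ := (bijectiveOnGradedHom_shift_left_iff n).2 h₂
    exact map_bijective_obj₃_right hT h₁.map_bijective.2 h₂.map_bijective (h₁ 1) (h₂ 1).1

lemma admissible_bijectiveOnGradedHom_left {S : Set C} {Y : C}
    (hS : ∀ X ∈ S, F.BijectiveOnGradedHom X Y) :
    Admissible S {X | F.BijectiveOnGradedHom X Y} := by
  refine ⟨hS, fun X hX n ↦ ?_, fun X X' e hX ↦ hX.of_retract (.ofIso e.symm) (.refl _),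
    fun X n ↦ (bijectiveOnGradedHom_shift_left_iff n).symm, fun T hT h₁ h₂ n ↦ ?_,
    fun X X' i r hir hX ↦ hX.of_retract ⟨i, r, hir⟩ (.refl _)⟩
  · exact ⟨fun _ _ _ ↦ hX.eq_of_src _ _, fun _ ↦ ⟨0, (F.map_isZero hX).eq_of_src _ _⟩⟩
  · exact map_bijective_obj₃_left hT (h₁ n).1 (h₂ n)
      ((bijectiveOnGradedHom_shift_left_iff 1).2 h₁ n)
      ((bijectiveOnGradedHom_shift_left_iff 1).2 h₂ n).2

end Triangulated

end CategoryTheory.Functor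

theorem fully_faithful_on_thick_subcategory_generated_by
    {C D : Type*} [Category C] [Category D]
    [HasZeroObject C] [HasZeroObject D] [Preadditive C] [Preadditive D]
    [HasShift C ℤ] [HasShift D ℤ]
    [∀ n : ℤ, (shiftFunctor C n).Additive] [∀ n : ℤ, (shiftFunctor D n).Additive]
    [Pretriangulated C] [Pretriangulated D]
    (F : C ⥤ D) [F.CommShift ℤ] [F.IsTriangulated]
    (S : Set C)
    (hS : ∀ A ∈ S, ∀ B ∈ S, ∀ n : ℤ,
      Function.Bijective (fun f : A⟦n⟧ ⟶ B => F.map f))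
    (A B : C)
    (hA : ∀ P : Set C, Admissible S P → A ∈ P)
    (hB : ∀ P : Set C, Admissible S P → B ∈ P) :
    Function.Bijective (fun f : A ⟶ B => F.map f) := by
  have hSB : ∀ X ∈ S, F.BijectiveOnGradedHom X B := fun X hX ↦
    hB _ (Functor.admissible_bijectiveOnGradedHom_right fun Y hY ↦
      Functor.bijectiveOnGradedHom_iff_left.2 (hS X hX Y hY))
  have hAB : F.BijectiveOnGradedHom A B :=
    hA _ (Functor.admissible_bijectiveOnGradedHom_left hSB)
  exact hAB.map_bijective
end
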